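/- Let U = F₂⁶ with the standard bilinear form ⟨x,y⟩ = Σ xᵢyᵢ, let U⁰ be the hyperplane of vectors with coordinate sum zero, let L be the span of (1,1,1,1,1,1), and let Z = U⁰/L. Then Z is a 4-dimensional F₂-vector space and the induced alternating bilinear form on Z is nondegenerate; consequently the coordinate-permutation action of S₆ on U induces an injective group homomorphism S₆ → Sp₄(F₂). -/

import Mathlib

open scoped BigOperators

/-- The trace-zero hyperplane `U⁰ ⊂ U = F₂⁶` for the standard bilinear form. -/
def U0 : Submodule (ZMod 2) (Fin 6 → ZMod 2) where
  carrier := {x | ∑ i, x i = 0}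
  add_mem' := by
    intro a b ha hb
    simp only [Set.mem_setOf_eq, Pi.add_apply, Finset.sum_add_distrib] at *
    simp [ha, hb]
  zero_mem' := by simp
  smul_mem' := by
    intro c x hx
    simp only [Set.mem_setOf_eq, Pi.smul_apply, smul_eq_mul, ← Finset.mul_sum] at *
    simp [hx]

lemma mem_U0 {x : Fin 6 → ZMod 2} : x ∈ U0 ↔ ∑ i, x i = 0 := Iff.rfl

/-- The all-ones vector `(1,1,1,1,1,1)`, an element of `U⁰`. -/
def allOnes : U0 := ⟨fun _ => 1, by rw [mem_U0]; decide⟩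

/-- The line `L` spanned by the all-ones vector. -/
def Lsub : Submodule (ZMod 2) U0 := Submodule.span (ZMod 2) {allOnes}

/-- The quotient `Z = U⁰/L`. -/
abbrev Zq := U0 ⧸ Lsub

lemma perm_mem (g : Equiv.Perm (Fin 6)) {x : Fin 6 → ZMod 2} (hx : x ∈ U0) :
    (fun i => x (g⁻¹ i)) ∈ U0 := by
  rw [mem_U0] at hx ⊢
  rw [Equiv.sum_comp g⁻¹ x]
  exact hx

lemma mem_Lsub {x : U0} : x ∈ Lsub ↔ ∀ i j, x.1 i = x.1 j := by
  rw [Lsub, Submodule.mem_span_singleton]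
  constructor
  · rintro ⟨c, rfl⟩ i j
    rfl
  · intro h
    refine ⟨x.1 0, ?_⟩
    ext i
    simp [allOnes, h 0 i]

/-- The weight-two vector `eᵢ + eⱼ` of `U⁰`. -/
def pairVec (i j : Fin 6) : U0 :=
  ⟨Pi.single i 1 + Pi.single j 1, by
    simp only [mem_U0, Pi.add_apply, Finset.sum_add_distrib, Finset.sum_pi_single',
      Finset.mem_univ, if_true]
    exact CharTwo.add_self_eq_zero 1⟩

lemma finrank_U0 : Module.finrank (ZMod 2) U0 = 5 := by
  let f : Module.Dual (ZMod 2) (Fin 6 → ZMod 2) := ∑ i, LinearMap.proj i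
  have hker : LinearMap.ker f = U0 := by
    ext x
    simp [f, mem_U0]
  have hf : f ≠ 0 := by
    intro h
    have := LinearMap.congr_fun h (Pi.single 0 1)
    simp [f] at this
  have := Module.Dual.finrank_ker_add_one_of_ne_zero hf
  rw [hker, Module.finrank_fin_fun] at this
  omega

lemma finrank_Zq : Module.finrank (ZMod 2) Zq = 4 := by
  have hne : allOnes ≠ 0 := fun h => one_ne_zero (congrFun (congrArg Subtype.val h) 0)
  have := Lsub.finrank_quotient_add_finrank
  rw [finrank_U0, show Module.finrank (ZMod 2) Lsub = 1 from finrank_span_singleton hne] at this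
  exact Nat.add_right_cancel this

/-- The standard form restricted to `U⁰`. -/
def dotU0 : U0 →ₗ[ZMod 2] U0 →ₗ[ZMod 2] ZMod 2 :=
  (dotProductBilin (ZMod 2) (ZMod 2)).domRestrict₁₂ U0 U0

lemma dotU0_apply (x y : U0) : dotU0 x y = ∑ i, x.1 i * y.1 i := rfl

lemma dotU0_comm (x y : U0) : dotU0 x y = dotU0 y x := by
  simp only [dotU0_apply, mul_comm]

lemma dotU0_self (x : U0) : dotU0 x x = 0 := by
  have hsq : ∀ a : ZMod 2, a * a = a := by decide
  simpa only [dotU0_apply, hsq] using mem_U0.1 x.2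

lemma dotU0_pairVec (x : U0) (i j : Fin 6) : dotU0 x (pairVec i j) = x.1 i + x.1 j := by
  simp [dotU0_apply, pairVec, mul_add, Finset.sum_add_distrib, Pi.single_apply]

lemma dotU0_eq_zero_of_mem_Lsub {x : U0} (hx : x ∈ Lsub) : dotU0 x = 0 := by
  ext y
  have hy : ∑ i, y.1 i = 0 := y.2
  simp [dotU0_apply, mem_Lsub.1 hx _ 0, ← Finset.mul_sum, hy]

/-- The form induced on `Z` by the standard form. -/
def formZ : Zq →ₗ[ZMod 2] Zq →ₗ[ZMod 2] ZMod 2 :=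
  dotU0.liftQ₂ Lsub Lsub
    (fun _ hx => dotU0_eq_zero_of_mem_Lsub hx)
    fun y hy => by
      ext x
      simp [dotU0_comm x y, dotU0_eq_zero_of_mem_Lsub hy]

lemma formZ_mk (x y : U0) :
    formZ (Submodule.Quotient.mk x) (Submodule.Quotient.mk y) = dotU0 x y := rfl

lemma formZ_nondegenerate (z : Zq) (h : ∀ w, formZ z w = 0) : z = 0 := by
  obtain ⟨x, rfl⟩ := Submodule.Quotient.mk_surjective _ z
  rw [Submodule.Quotient.mk_eq_zero, mem_Lsub]
  intro i j
  rw [← CharTwo.add_eq_zero, ← dotU0_pairVec, ← formZ_mk, h]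

/-- The coordinate permutation action on `U⁰`. -/
def permU0 (g : Equiv.Perm (Fin 6)) : U0 →ₗ[ZMod 2] U0 :=
  (LinearMap.funLeft (ZMod 2) (ZMod 2) ⇑g⁻¹).restrict fun _ => perm_mem g

lemma permU0_apply (g : Equiv.Perm (Fin 6)) (x : U0) (i : Fin 6) :
    (permU0 g x).1 i = x.1 (g⁻¹ i) := rfl

lemma dotU0_permU0 (g : Equiv.Perm (Fin 6)) (x y : U0) :
    dotU0 (permU0 g x) (permU0 g y) = dotU0 x y :=
  Equiv.sum_comp g⁻¹ fun i => x.1 i * y.1 i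

/-- The representation of `S₆` on `Z`. -/
def permRep : Representation (ZMod 2) (Equiv.Perm (Fin 6)) Zq where
  toFun g := Lsub.mapQ Lsub (permU0 g) fun _ hx =>
    mem_Lsub.2 fun i j => mem_Lsub.1 hx (g⁻¹ i) (g⁻¹ j)
  map_one' := by
    ext x
    rfl
  map_mul' g h := by
    ext x
    simp only [LinearMap.comp_apply, Module.End.mul_apply, Submodule.mkQ_apply,
      Submodule.mapQ_apply]
    congr 1

/-- The homomorphism from `S₆` to the linear automorphisms of `Z`. -/
def permZ : Equiv.Perm (Fin 6) →* (Zq ≃ₗ[ZMod 2] Zq) :=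
  (LinearMap.GeneralLinearGroup.generalLinearEquiv (ZMod 2) Zq).toMonoidHom.comp permRep.toHomUnits

lemma permZ_mk (g : Equiv.Perm (Fin 6)) (x : U0) :
    permZ g (Submodule.Quotient.mk x) = Submodule.Quotient.mk (permU0 g x) := rfl

lemma permZ_injective : Function.Injective permZ := by
  rw [injective_iff_map_eq_one]
  intro g hg
  ext1 i
  by_contra! hi
  rw [Equiv.Perm.one_apply] at hi
  obtain ⟨j, hj⟩ := Finset.exists_mem_notMem_of_card_lt_card
    (s := {i, g i}) (t := Finset.univ) (Finset.card_le_two.trans_lt (by simp))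
  obtain ⟨l, hl⟩ := Finset.exists_mem_notMem_of_card_lt_card
    (s := {i, j, g i, g j}) (t := Finset.univ) (Finset.card_le_four.trans_lt (by simp))
  simp only [Finset.mem_univ, Finset.mem_insert, Finset.mem_singleton, not_or, true_and] at hj hl
  have hmem : permU0 g (pairVec i j) - pairVec i j ∈ Lsub := by
    rw [← Submodule.Quotient.eq, ← permZ_mk, hg]
    rfl
  have hl' : g.symm l ≠ i ∧ g.symm l ≠ j := by
    simpa only [ne_eq, Equiv.symm_apply_eq] using hl.2.2
  have := mem_Lsub.1 hmem (g i) l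
  simp [permU0_apply, pairVec, hi, hl, hl', Ne.symm hj.1, Ne.symm hj.2] at this

/-- `Z = U⁰/L` is a 4-dimensional `F₂`-vector space, the induced bilinear form on `Z`
(descending the standard form `⟨x,y⟩ = Σ xᵢyᵢ`) is alternating and nondegenerate, and
the coordinate-permutation action of `S₆` induces an injective group homomorphism of
`S₆` into the linear automorphisms of `Z` preserving the symplectic form, i.e. into
`Sp₄(F₂)`. -/
theorem stmt_9 :
    Module.finrank (ZMod 2) Zq = 4 ∧
    ∃ B : Zq →ₗ[ZMod 2] Zq →ₗ[ZMod 2] ZMod 2,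
      (∀ x y : U0, B (Submodule.Quotient.mk x) (Submodule.Quotient.mk y)
          = ∑ i, (x : Fin 6 → ZMod 2) i * (y : Fin 6 → ZMod 2) i) ∧
      (∀ z : Zq, B z z = 0) ∧
      (∀ z : Zq, (∀ w : Zq, B z w = 0) → z = 0) ∧
      ∃ φ : Equiv.Perm (Fin 6) →* (Zq ≃ₗ[ZMod 2] Zq),
        Function.Injective φ ∧
        (∀ (g : Equiv.Perm (Fin 6)) (z w : Zq), B (φ g z) (φ g w) = B z w) ∧
        (∀ (g : Equiv.Perm (Fin 6)) (x : Fin 6 → ZMod 2) (hx : x ∈ U0),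
          φ g (Submodule.Quotient.mk ⟨x, hx⟩)
            = Submodule.Quotient.mk ⟨fun i => x (g⁻¹ i), perm_mem g hx⟩) := by
  refine ⟨finrank_Zq, formZ, fun _ _ => rfl, ?_, formZ_nondegenerate, permZ, permZ_injective, ?_,
    fun _ _ _ => rfl⟩
  · intro z
    obtain ⟨x, rfl⟩ := Submodule.Quotient.mk_surjective _ z
    exact dotU0_self x
  · intro g z w
    obtain ⟨x, rfl⟩ := Submodule.Quotient.mk_surjective _ z
    obtain ⟨y, rfl⟩ := Submodule.Quotient.mk_surjective _ w
    exact dotU0_permU0 g x y
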